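/- Let (F_i)_{i ≥ 1} be cumulative distribution functions converging pointwise on ℝ to a continuous cumulative distribution function F_0, let μ_0 ∈ ℝ, and let (T_i)_{i ≥ 1} be real-valued random variables on a probability space (Ω, 𝓕, P) with T_i → μ_0 in probability as i → ∞ (for every ε > 0, P(|T_i − μ_0| > ε) → 0). Then E[F_i(T_i)] → F_0(μ_0) as i → ∞. -/

import Mathlib

open MeasureTheory ProbabilityTheory Filter

/-- A cumulative distribution function: monotone nondecreasing, right-continuous,
tending to 0 at -∞ and to 1 at +∞. -/
def IsCDF (F : ℝ → ℝ) : Prop :=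
  Monotone F ∧ (∀ x : ℝ, ContinuousWithinAt F (Set.Ici x) x) ∧
    Tendsto F atBot (nhds (0 : ℝ)) ∧ Tendsto F atTop (nhds (1 : ℝ))

theorem IsCDF.nonneg {F : ℝ → ℝ} (hF : IsCDF F) (x : ℝ) : 0 ≤ F x :=
  hF.1.le_of_tendsto hF.2.2.1 x

theorem IsCDF.le_one {F : ℝ → ℝ} (hF : IsCDF F) (x : ℝ) : F x ≤ 1 :=
  hF.1.ge_of_tendsto hF.2.2.2 x

/-- Monotone functions converging pointwise to a function continuous at `a` are eventually
uniformly close to its value at `a` on a neighborhood of `a`. -/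
theorem exists_eventually_abs_sub_lt_of_monotone {F : ℕ → ℝ → ℝ} {F₀ : ℝ → ℝ} {a : ℝ}
    (hF : ∀ i, Monotone (F i)) (hF₀ : ContinuousAt F₀ a)
    (hlim : ∀ x, Tendsto (fun i => F i x) atTop (nhds (F₀ x))) {ε : ℝ} (hε : 0 < ε) :
    ∃ δ > 0, ∀ᶠ i in atTop, ∀ x, |x - a| ≤ δ → |F i x - F₀ a| < ε := by
  obtain ⟨δ, hδ, h⟩ := Metric.continuousAt_iff.1 hF₀ ε hε
  have hl : |F₀ (a - δ / 2) - F₀ a| < ε := by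
    apply h
    rw [Real.dist_eq, abs_lt]
    constructor <;> linarith
  have hr : |F₀ (a + δ / 2) - F₀ a| < ε := by
    apply h
    rw [Real.dist_eq, abs_lt]
    constructor <;> linarith
  rw [abs_lt] at hl hr
  refine ⟨δ / 2, half_pos hδ, ?_⟩
  filter_upwards [(hlim (a - δ / 2)).eventually_const_lt (u := F₀ a - ε) (by linarith),
    (hlim (a + δ / 2)).eventually_lt_const (u := F₀ a + ε) (by linarith)] with i hil hir x hx
  rw [abs_le] at hx
  have hxl := hF i (show a - δ / 2 ≤ x by linarith)
  have hxr := hF i (show x ≤ a + δ / 2 by linarith)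
  rw [abs_lt]
  constructor <;> linarith

/-- **E[F i (T i)] → F₀(μ₀).** If CDFs `F i` converge pointwise to a continuous
CDF `F₀` and `T i → μ₀` in probability, then `E[F i (T i)] → F₀ μ₀`. -/
theorem integral_cdf_tendsto
    {Ω : Type*} [MeasurableSpace Ω] (P : Measure Ω) [IsProbabilityMeasure P]
    (F : ℕ → ℝ → ℝ) (F₀ : ℝ → ℝ)
    (hF : ∀ i, IsCDF (F i)) (hF₀ : IsCDF F₀) (hF₀cont : Continuous F₀)
    (hFlim : ∀ x : ℝ, Tendsto (fun i => F i x) atTop (nhds (F₀ x)))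
    (μ₀ : ℝ) (T : ℕ → Ω → ℝ) (hTmeas : ∀ i, Measurable (T i))
    (hTlim : ∀ ε > (0 : ℝ),
      Tendsto (fun i => P {ω | ε < |T i ω - μ₀|}) atTop (nhds 0)) :
    Tendsto (fun i => ∫ ω, F i (T i ω) ∂P) atTop (nhds (F₀ μ₀)) := by
  rw [Metric.tendsto_nhds]
  intro ε hε
  obtain ⟨δ, hδ, hclose⟩ := exists_eventually_abs_sub_lt_of_monotone (fun i => (hF i).1)
    hF₀cont.continuousAt hFlim (half_pos hε)
  have hbad : Tendsto (fun i => P.real {ω | δ < |T i ω - μ₀|}) atTop (nhds 0) := by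
    simpa [Measure.real, Function.comp_def] using
      (ENNReal.tendsto_toReal ENNReal.zero_ne_top).comp (hTlim δ hδ)
  filter_upwards [hclose, hbad.eventually_lt_const (half_pos hε)] with i hi hPi
  have hmeas : MeasurableSet {ω | δ < |T i ω - μ₀|} :=
    measurableSet_lt measurable_const ((hTmeas i).sub_const μ₀).abs
  have hint : Integrable (fun ω => F i (T i ω)) P := by
    refine Integrable.of_bound (((hF i).1.measurable.comp (hTmeas i)).aestronglyMeasurable) 1
      (ae_of_all _ fun ω => ?_)
    rw [Real.norm_eq_abs, abs_of_nonneg ((hF i).nonneg _)]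
    exact (hF i).le_one _
  have hind : Integrable ({ω | δ < |T i ω - μ₀|}.indicator fun _ => (1 : ℝ)) P :=
    (integrable_const 1).indicator hmeas
  have hpt (ω : Ω) : ‖F i (T i ω) - F₀ μ₀‖ ≤
      ε / 2 + {ω | δ < |T i ω - μ₀|}.indicator (fun _ => (1 : ℝ)) ω := by
    rw [Real.norm_eq_abs]
    by_cases hω : δ < |T i ω - μ₀|
    · rw [Set.indicator_of_mem (by exact hω), abs_le]
      have h₀ := hF₀.nonneg μ₀
      have h₁ := hF₀.le_one μ₀
      have h₂ := (hF i).nonneg (T i ω)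
      have h₃ := (hF i).le_one (T i ω)
      constructor <;> linarith
    · rw [Set.indicator_of_notMem (by exact hω), add_zero]
      exact (hi _ (not_lt.1 hω)).le
  calc dist (∫ ω, F i (T i ω) ∂P) (F₀ μ₀)
      = ‖∫ ω, (F i (T i ω) - F₀ μ₀) ∂P‖ := by
        rw [integral_sub hint (integrable_const _), integral_const, probReal_univ, one_smul,
          dist_eq_norm]
    _ ≤ ∫ ω, (ε / 2 + {ω | δ < |T i ω - μ₀|}.indicator (fun _ => (1 : ℝ)) ω) ∂P :=
        norm_integral_le_of_norm_le ((integrable_const _).add hind) (ae_of_all _ hpt)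
    _ = ε / 2 + P.real {ω | δ < |T i ω - μ₀|} := by
        rw [integral_add (integrable_const _) hind, integral_const, probReal_univ, one_smul,
          integral_indicator_const _ hmeas, smul_eq_mul, mul_one]
    _ < ε := by linarith
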